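/- Let (X,(f_n)) be a converging situation, P a Borel subset of X such that A^f ∩ P² is not pot(Π⁰₁), and σ a finer Polish topology on P. Then there exist a Borel subset S of P and a topology τ on S finer than the topology induced by σ such that ([S,τ],(f^S_n)_n) is a converging situation. -/

import Mathlib

open Set Topology

abbrev Cantor : Type := ℕ → Bool

/-- `A ⊆ X × Y` is potentially closed (`pot(Π⁰₁)`): there are finer Polish topologies on `X`
and `Y` making `A` closed in the product. -/
def PotClosed {X Y : Type} (tX : TopologicalSpace X) (tY : TopologicalSpace Y)
    (A : Set (X × Y)) : Prop :=
  ∃ (σ : TopologicalSpace X) (τ : TopologicalSpace Y),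
    σ ≤ tX ∧ τ ≤ tY ∧ @PolishSpace X σ ∧ @PolishSpace Y τ ∧
    @IsClosed (X × Y) (@instTopologicalSpaceProd X Y σ τ) A

/-- Membership in the class `D₂(Σ⁰₁)`: difference of two open sets. -/
def D2Sigma01 {Z : Type} (t : TopologicalSpace Z) (A : Set Z) : Prop :=
  ∃ U V : Set Z, @IsOpen Z t U ∧ @IsOpen Z t V ∧ A = U \ V

/-- The rectangular continuous reducibility `A ≤ʳ_c A'`. -/
def RedRC {X Y X' Y' : Type} (tX : TopologicalSpace X) (tY : TopologicalSpace Y)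
    (tX' : TopologicalSpace X') (tY' : TopologicalSpace Y')
    (A : Set (X × Y)) (A' : Set (X' × Y')) : Prop :=
  ∃ (u : X → X') (v : Y → Y'),
    @Continuous X X' tX tX' u ∧ @Continuous Y Y' tY tY' v ∧
    A = (fun p => (u p.1, v p.2)) ⁻¹' A'

/-- `≤ʳ_c` on subsets of `Cantor × Cantor` with the standard topology. -/
def RedC2 (A A' : Set (Cantor × Cantor)) : Prop :=
  RedRC inferInstance inferInstance inferInstance inferInstance A A'

/-- `A` is `≤ʳ_c`-minimal among non-potentially closed Borel sets. -/
def MinNonPotClosed {X Y : Type} (tX : TopologicalSpace X) (tY : TopologicalSpace Y)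
    (A : Set (X × Y)) : Prop :=
  ¬ PotClosed tX tY A ∧
  ∀ (X' Y' : Type) (tX' : TopologicalSpace X') (tY' : TopologicalSpace Y'),
    @PolishSpace X' tX' → @PolishSpace Y' tY' →
    ∀ A' : Set (X' × Y'),
      @MeasurableSet (X' × Y') (@borel (X' × Y') (@instTopologicalSpaceProd X' Y' tX' tY')) A' →
      ¬ PotClosed tX' tY' A' →
      RedRC tX' tY' tX tY A' A → RedRC tX tY tX' tY' A A'

/-- The Borel reducibility `A ≤_B A'` for square sets. -/
def RedB {Z Z' : Type} (tZ : TopologicalSpace Z) (tZ' : TopologicalSpace Z')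
    (A : Set (Z × Z)) (A' : Set (Z' × Z'))  : Prop :=
  ∃ u : Z → Z', @Measurable Z Z' (@borel Z tZ) (@borel Z' tZ') u ∧
    A = (fun p => (u p.1, u p.2)) ⁻¹' A'

/-- `A` is `≤_B`-minimal among non-potentially closed Borel (square) sets. -/
def MinBNonPotClosed {Z : Type} (tZ : TopologicalSpace Z) (A : Set (Z × Z)) : Prop :=
  ¬ PotClosed tZ tZ A ∧
  ∀ (Z' : Type) (tZ' : TopologicalSpace Z'), @PolishSpace Z' tZ' →
    ∀ A' : Set (Z' × Z'),
      @MeasurableSet (Z' × Z') (@borel (Z' × Z') (@instTopologicalSpaceProd Z' Z' tZ' tZ')) A' →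
      ¬ PotClosed tZ' tZ' A' →
      RedB tZ' tZ A' A → RedB tZ tZ' A A'

/-- The graph of the partial function `f` with domain `D`. -/
def graphRel {X : Type} (D : Set X) (f : X → X) : Set (X × X) :=
  {p | p.1 ∈ D ∧ p.2 = f p.1}

/-- `A^f := ⋃ₙ Graph(fₙ)`. -/
def unionGraphs {X : Type} (D : ℕ → Set X) (f : ℕ → X → X) : Set (X × X) :=
  ⋃ n, graphRel (D n) (f n)

/-- `f` restricted to `D` is a partial homeomorphism with clopen domain and clopen range. -/
def IsPartialHomeo {X : Type} (t : TopologicalSpace X) (D : Set X) (f : X → X) : Prop :=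
  @IsClopen X t D ∧ @IsClopen X t (f '' D) ∧ @ContinuousOn X X t t f D ∧
    ∃ g : X → X, @ContinuousOn X X t t g (f '' D) ∧ ∀ x ∈ D, g (f x) = x

/-- A converging situation: a nonempty zero-dimensional perfect Polish space together with
partial homeomorphisms with clopen domains and ranges such that
`Δ(X) = closure(A^f) \ A^f`. -/
def ConvSit (X : Type) (t : TopologicalSpace X) (D : ℕ → Set X) (f : ℕ → X → X) : Prop :=
  Nonempty X ∧ @PolishSpace X t ∧
  @TopologicalSpace.IsTopologicalBasis X t {s : Set X | @IsClopen X t s} ∧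
  @Perfect X t Set.univ ∧
  (∀ n, IsPartialHomeo t (D n) (f n)) ∧
  Set.diagonal X =
    @closure (X × X) (@instTopologicalSpaceProd X X t t) (unionGraphs D f) \ unionGraphs D f

/-- The domain of the restriction `f^B` of the partial map `(D, f)` to a subset `B`. -/
def subD {X : Type} (B : Set X) (D : Set X) (f : X → X) : Set ↥B :=
  {x | (x : X) ∈ D ∧ f (x : X) ∈ B}

/-- The restriction `f^B` of `f` to `B`, as a map of the subtype (junk value outside). -/
noncomputable def subF {X : Type} (B : Set X) (f : X → X) : ↥B → ↥B :=
  fun x =>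
    letI := Classical.dec (f (x : X) ∈ B)
    if h : f (x : X) ∈ B then ⟨f (x : X), h⟩ else x

/-- `A^f ∩ B²`, viewed on the subtype `B`: the union of the graphs of the `f^B_n`'s. -/
def restrGraphs {X : Type} (B : Set X) (D : ℕ → Set X) (f : ℕ → X → X) : Set (↥B × ↥B) :=
  unionGraphs (fun n => subD B (D n) (f n)) (fun n => subF B (f n))

/-- The subspace topology on `B` induced by a topology `t` on `X`. -/
def subTop {X : Type} (t : TopologicalSpace X) (B : Set X) : TopologicalSpace ↥B :=
  @TopologicalSpace.induced ↥B X Subtype.val t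

/-- The natural bijection `ψ : ω → 2^{<ω}` (enumeration by length, then lexicographically):
`ψ(n)` is the binary expansion of `n+1` with its leading one removed. -/
def psiSeq (n : ℕ) : List Bool := ((n + 1).bits.dropLast).reverse

/-- `s_n := ψ(n)0^{n-|ψ(n)|}`, a dense sequence with `|s_n| = n`. -/
def sSeq (n : ℕ) : List Bool := psiSeq n ++ List.replicate (n - (psiSeq n).length) false

/-- The concatenation `sγ` of a finite sequence `s` with `γ ∈ 2^ω`. -/
def catSeq (s : List Bool) (γ : Cantor) : Cantor :=
  fun i => if h : i < s.length then s.get ⟨i, h⟩ else γ (i - s.length)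

/-- `A₁ := {(s_n0γ, s_n1γ) : n ∈ ω, γ ∈ 2^ω}`. -/
def A1 : Set (Cantor × Cantor) :=
  {p | ∃ (n : ℕ) (γ : Cantor),
    p.1 = catSeq (sSeq n ++ [false]) γ ∧ p.2 = catSeq (sSeq n ++ [true]) γ}

/-- `Card(x↾n)`: the number of ones among the first `n` coordinates of `x`. -/
def cardOnes (x : Cantor) (n : ℕ) : ℕ := ∑ i ∈ Finset.range n, (if x i then 1 else 0)

/-- The domain of `f^S_n`: sequences vanishing at `n` whose first `n` coordinates contain a
number of ones belonging to `S`. -/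
def DSdom (S : Set ℕ) (n : ℕ) : Set Cantor := {x | x n = false ∧ cardOnes x n ∈ S}

/-- `f^S_n (s0γ) := s1γ`: flip the `n`-th coordinate to one. -/
def fSfun (n : ℕ) : Cantor → Cantor := fun x => Function.update x n true

/-- `A^S := {(s0γ, s1γ) : s ∈ 2^{<ω}, Card(s) ∈ S, γ ∈ 2^ω} = ⋃ₙ Graph(f^S_n)`. -/
def ASet (S : Set ℕ) : Set (Cantor × Cantor) := unionGraphs (DSdom S) fSfun

/-- Condition (M) on `S ⊆ ω`. -/
def CondM (S : Set ℕ) : Prop :=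
  ∀ p : ℕ, ∃ k : ℕ, ∀ q : ℕ, ∃ c : ℕ, q ≤ c ∧ c ≤ q + k ∧
    (fun m => c + m) '' (S ∩ Set.Iic p) = S ∩ Set.Icc c (c + p)

/-- Condition (H) on `S ⊆ ω`. -/
def CondH (S : Set ℕ) : Prop :=
  ∀ C : Set Cantor, @MeasurableSet Cantor (borel Cantor) C →
    ∀ σ : TopologicalSpace ↥C, σ ≤ subTop inferInstance C →
      ConvSit ↥C σ (fun n => subD C (DSdom S n) (fSfun n)) (fun n => subF C (fSfun n)) →
      ∀ l p : ℕ, ∃ n : ℕ, l ≤ n ∧ ∃ γ : ↥C, γ ∈ subD C (DSdom S n) (fSfun n) ∧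
        (fun m => cardOnes (γ : Cantor) n + m) '' (S ∩ Set.Iic p) =
          S ∩ Set.Icc (cardOnes (γ : Cantor) n) (cardOnes (γ : Cantor) n + p)

/-- Condition (⊥) on a pair `(S, S')`. -/
def CondPerp (S S' : Set ℕ) : Prop :=
  ∃ p : ℕ, ∀ c : ℕ, (fun m => c + m) '' (S ∩ Set.Iic p) ≠ S' ∩ Set.Icc c (c + p)

/-- Condition (⊥⁻¹) on a pair `(S, S')` (stated in `ℤ` to handle subtraction). -/
def CondPerpInv (S S' : Set ℕ) : Prop :=
  ∃ p : ℕ, ∀ c : ℕ,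
    (fun m : ℕ => (c : ℤ) - (m : ℤ)) '' (S ∩ Set.Iic p) ≠
      ((fun n : ℕ => (n : ℤ)) '' S') ∩ Set.Icc ((c : ℤ) - (p : ℤ)) (c : ℤ)

/-- `A⁻¹ := {(y,x) : (x,y) ∈ A}`. -/
def invRel {X : Type} (A : Set (X × X)) : Set (X × X) := {p | (p.2, p.1) ∈ A}

/-- `γ_α`: `γ_α(4n+2ε) = ε` and `γ_α(2n+1) = α(n)`. -/
def gammaSeq (α : Cantor) (k : ℕ) : Bool :=
  if k % 2 = 1 then α (k / 2) else decide (k % 4 = 2)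

/-- `β_α(i) := γ_α((i)₀)` where `(i)₀ = max {m : 2^m ∣ i+1}`, with values in `{0,1} ⊆ ω`. -/
def betaSeq (α : Cantor) (i : ℕ) : ℕ :=
  if gammaSeq α ((i + 1).factorization 2) then 1 else 0

/-- `S_β := {Σ_{i<l} (1 + β(i)) : l ∈ ω}`. -/
def Sbeta (β : ℕ → ℕ) : Set ℕ :=
  {m | ∃ l : ℕ, m = ∑ i ∈ Finset.range l, (1 + β i)}

/-- `s_n` as a function `ℕ → Bool` (with junk value `false` beyond `n`). -/
def sSeqFn (n : ℕ) (i : ℕ) : Bool := (sSeq n).getD i false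

/-- The domain of `f¹_n` (direction `d = true`) or of `(f¹_n)⁻¹` (direction `d = false`):
`x` extends `s_n` and `x(n) = !d`. -/
def step1Dom (n : ℕ) (d : Bool) : Set Cantor :=
  {x | (∀ i, i < n → x i = sSeqFn n i) ∧ x n = !d}

/-- `f¹_n` (if `d = true`) or its inverse (if `d = false`): set the `n`-th coordinate to `d`. -/
def step1Fun (n : ℕ) (d : Bool) : Cantor → Cantor := fun x => Function.update x n d

/-- Domain of `fₙ` (direction `d = true`) or of `fₙ⁻¹` (direction `d = false`). -/
def stepDom {X : Type} (D : ℕ → Set X) (f : ℕ → X → X) (n : ℕ) (d : Bool) : Set X :=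
  if d then D n else f n '' D n

/-- `fₙ` (direction `d = true`) or its inverse `gₙ` (direction `d = false`). -/
def stepFun {X : Type} (f g : ℕ → X → X) (n : ℕ) (d : Bool) : X → X :=
  if d then f n else g n

/-- An acyclic situation (Definition 26), with `g n` the inverse of `f n`. -/
def AcyclicSit (X : Type) (t : TopologicalSpace X) (D : ℕ → Set X) (f g : ℕ → X → X) : Prop :=
  Nonempty X ∧ @PolishSpace X t ∧
  @TopologicalSpace.IsTopologicalBasis X t {s : Set X | @IsClopen X t s} ∧
  @Perfect X t Set.univ ∧
  (∀ n, IsPartialHomeo t (D n) (f n)) ∧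
  (∀ n, ∀ x ∈ D n, g n (f n x) = x) ∧
  Set.diagonal X ⊆
    @closure (X × X) (@instTopologicalSpaceProd X X t t) (unionGraphs D f) \ unionGraphs D f ∧
  (∀ m : ℕ, 1 ≤ m → ∀ (v : ℕ → ℕ) (ε : ℕ → Bool),
    (∀ i, i + 1 < m → v i ≠ v (i + 1) ∨ ε i = ε (i + 1)) →
    ∀ U : Set X, @IsClopen X t U → U.Nonempty →
      ∃ V : Set X, @IsClopen X t V ∧ V.Nonempty ∧ V ⊆ U ∧
        ∀ x ∈ V, ∀ w : ℕ → X, w 0 = x →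
          (∀ i, i < m → w i ∈ stepDom D f (v i) (ε i) ∧
            w (i + 1) = stepFun f g (v i) (ε i) (w i)) →
          w m ∉ V)

/-- The relation `ℜ_Θ` on `2^{<ω}`: `e ℜ_Θ e'` iff `e = e'` or
`(e, e') = (θ_n0w, θ_n1w)` for some `n` and `w`. -/
def RTheta (θ : ℕ → List Bool) (e e' : List Bool) : Prop :=
  e = e' ∨ ∃ (n : ℕ) (w : List Bool), e = θ n ++ false :: w ∧ e' = θ n ++ true :: w

/-- The symmetrization `s(ℜ_Θ)`. -/
def sRTheta (θ : ℕ → List Bool) (e e' : List Bool) : Prop :=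
  RTheta θ e e' ∨ RTheta θ e' e

/-- Countably many Borel sets can be made clopen by a single finer Polish topology. -/
theorem exists_polish_forall_isClopen {Q : Type} [σ : TopologicalSpace Q] [PolishSpace Q]
    [MeasurableSpace Q] [BorelSpace Q] {𝓒 : Set (Set Q)} (hc : 𝓒.Countable)
    (hm : ∀ C ∈ 𝓒, MeasurableSet C) :
    ∃ t : TopologicalSpace Q, t ≤ σ ∧ @PolishSpace Q t ∧ ∀ C ∈ 𝓒, @IsClopen Q t C := by
  have : Countable 𝓒 := hc
  choose t hle hpol hcl hop using fun C : 𝓒 => (hm C C.2).isClopenable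
  obtain ⟨t', h1, h2, h3⟩ := PolishSpace.exists_polishSpace_forall_le t hle hpol
  exact ⟨t', h2, h3, fun C hC =>
    ⟨(hcl ⟨C, hC⟩).mono (h1 _), h1 ⟨C, hC⟩ _ (hop ⟨C, hC⟩)⟩⟩

theorem exists_polish_refinement_step {Q : Type} [MeasurableSpace Q] {𝓦 : Set (Q → Q)}
    (hc : 𝓦.Countable) (hm : ∀ w ∈ 𝓦, Measurable w) {𝓔 : Set (Set Q)} (hEc : 𝓔.Countable)
    (hEm : ∀ E ∈ 𝓔, MeasurableSet E)
    (t : TopologicalSpace Q) (ht : @PolishSpace Q t) (hb : @BorelSpace Q t _) :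
    ∃ t' : TopologicalSpace Q, t' ≤ t ∧ @PolishSpace Q t' ∧ (∀ E ∈ 𝓔, @IsClopen Q t' E) ∧
      (∀ w ∈ 𝓦, Continuous[t', t] w) ∧
      ∃ B : Set (Set Q), @TopologicalSpace.IsTopologicalBasis Q t B ∧ ∀ b ∈ B, @IsClopen Q t' b := by
  obtain ⟨B, hBc, -, hB⟩ := TopologicalSpace.exists_countable_basis Q
  have hBm : ∀ b ∈ B, MeasurableSet b := fun b hb => (hB.isOpen hb).measurableSet
  obtain ⟨t', h1, h2, h3⟩ := exists_polish_forall_isClopen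
    (𝓒 := 𝓔 ∪ (B ∪ image2 (fun w b => w ⁻¹' b) 𝓦 B))
    (hEc.union (hBc.union (hc.image2 hBc _))) (by
      rintro C (h | h | ⟨w, hw, b, hb, rfl⟩)
      · exact hEm C h
      · exact hBm C h
      · exact hm w hw (hBm b hb))
  refine ⟨t', h1, h2, fun E hE => h3 E (.inl hE), fun w hw => ?_, B, hB,
    fun b hb => h3 b (.inr (.inl hb))⟩
  exact (@TopologicalSpace.IsTopologicalBasis.continuous_iff Q Q t' t B hB w).2 fun b hb => (h3 _ (.inr (.inr ⟨w, hw, b, hb, rfl⟩))).2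

/-- A Polish topology has a finer zero-dimensional Polish topology for which countably many Borel
self-maps become continuous and countably many Borel sets become clopen. -/
theorem exists_polish_zeroDim_refinement {Q : Type} [σ : TopologicalSpace Q] [PolishSpace Q]
    [MeasurableSpace Q] [BorelSpace Q] {𝓦 : Set (Q → Q)}
    (hc : 𝓦.Countable) (hm : ∀ w ∈ 𝓦, Measurable w) {𝓔 : Set (Set Q)} (hEc : 𝓔.Countable)
    (hEm : ∀ E ∈ 𝓔, MeasurableSet E) :
    ∃ t : TopologicalSpace Q, t ≤ σ ∧ @PolishSpace Q t ∧
      @TopologicalSpace.IsTopologicalBasis Q t {s | @IsClopen Q t s} ∧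
      (∀ w ∈ 𝓦, Continuous[t, t] w) ∧ ∀ E ∈ 𝓔, @IsClopen Q t E := by
  have hbor : ∀ t : TopologicalSpace Q, t ≤ σ → @PolishSpace Q t → @BorelSpace Q t _ := by
    intro t hle hp
    refine @BorelSpace.mk Q t _ ?_
    rw [MeasureTheory.borel_eq_borel_of_le hp ‹_› hle]
    exact BorelSpace.measurable_eq
  choose! next h1 h2 h3 h4 B hB hBc using exists_polish_refinement_step hc hm hEc hEm
  let T : ℕ → TopologicalSpace Q := fun n => next^[n] σ
  have hsucc : ∀ n, T (n + 1) = next (T n) := fun n => Function.iterate_succ_apply' _ _ _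
  have hT : ∀ n, T n ≤ σ ∧ @PolishSpace Q (T n) := by
    intro n
    induction n with
    | zero => exact ⟨le_rfl, ‹_›⟩
    | succ n ih =>
      rw [hsucc]
      have hb := hbor _ ih.1 ih.2
      exact ⟨(h1 _ ih.2 hb).trans ih.1, h2 _ ih.2 hb⟩
  have hbT := fun n => hbor _ (hT n).1 (hT n).2
  have hanti : Antitone T := antitone_nat_of_succ_le fun n => by
    rw [hsucc]; exact h1 _ (hT n).2 (hbT n)
  have hpol : @PolishSpace Q (⨅ n, T n) :=
    PolishSpace.iInf ⟨0, fun n => (hT n).1⟩ fun n => (hT n).2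
  have hcl : ∀ n (s : Set Q), @IsClopen Q (T n) s → @IsClopen Q (⨅ n, T n) s := fun n s hs =>
    ⟨hs.1.mono (iInf_le _ n), iInf_le T n _ hs.2⟩
  refine ⟨⨅ n, T n, iInf_le T 0, hpol, ?_, fun w hw => ?_, fun E hE => ?_⟩
  · let : TopologicalSpace Q := ⨅ n, T n
    refine TopologicalSpace.isTopologicalBasis_of_isOpen_of_nhds (fun s hs => hs.2) ?_
    intro x U hx hU
    have hU' : U ∈ @nhds Q (⨅ n, T n) x := hU.mem_nhds hx
    rw [_root_.nhds_iInf, Filter.mem_iInf_of_directed] at hU'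
    · obtain ⟨n, hn⟩ := hU'
      obtain ⟨b, hb, hxb, hbU⟩ :=
        (@TopologicalSpace.IsTopologicalBasis.mem_nhds_iff Q (T n) x U _
          (hB _ (hT n).2 (hbT n))).1 hn
      exact ⟨b, hcl (n + 1) b (by rw [hsucc]; exact hBc _ (hT n).2 (hbT n) b hb), hxb, hbU⟩
    · exact directed_of_isDirected_le fun i j hij => nhds_mono (hanti hij)
  · rw [continuous_iInf_rng]
    intro n
    refine continuous_le_dom (iInf_le T (n + 1)) ?_
    rw [hsucc]
    exact h4 _ (hT n).2 (hbT n) w hw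
  · refine hcl 1 E ?_
    rw [hsucc]
    exact h3 _ (hT 0).2 (hbT 0) E hE

/-- If `Q` is not a countable union of measurable independent sets, then some nonempty set `Y` is
such that each of countably many monotone contracting operators sends it to a set that is either
empty or not independent. -/
theorem exists_nonempty_stable {Q C : Type} [MeasurableSpace Q] [Countable C]
    {Ind : Set Q → Prop} (hInd : ∀ s t : Set Q, s ⊆ t → Ind t → Ind s)
    (R : C → Set Q → Set Q) (hR : ∀ c, Monotone (R c)) (hRsub : ∀ c Y, R c Y ⊆ Y)
    (hRm : ∀ c Y, MeasurableSet Y → MeasurableSet (R c Y))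
    (hcover : ¬ ∃ 𝓒 : Set (Set Q), 𝓒.Countable ∧ (∀ s ∈ 𝓒, MeasurableSet s ∧ Ind s) ∧
      ⋃₀ 𝓒 = univ) :
    ∃ Y : Set Q, Y.Nonempty ∧ ∀ c, (R c Y).Nonempty → ¬ Ind (R c Y) := by
  let Small : Set Q → Prop := fun Z => ∃ 𝓒 : Set (Set Q), 𝓒.Countable ∧
    (∀ s ∈ 𝓒, MeasurableSet s ∧ Ind s) ∧ Z ⊆ ⋃₀ 𝓒
  have hSmall_iUnion : ∀ Z : C → Set Q, (∀ c, Small (Z c)) → Small (⋃ c, Z c) := by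
    intro Z hZ
    choose 𝓒 h1 h2 h3 using hZ
    refine ⟨⋃ c, 𝓒 c, countable_iUnion h1, fun s hs => ?_, iUnion_subset fun c x hx => ?_⟩
    · obtain ⟨c, hc⟩ := mem_iUnion.1 hs
      exact h2 c s hc
    · obtain ⟨s, hs, hxs⟩ := h3 c hx
      exact ⟨s, mem_iUnion.2 ⟨c, hs⟩, hxs⟩
  have hpick : ∀ c, ∃ Y : Set Q, MeasurableSet Y ∧ Small Yᶜ ∧
      ∀ Y', MeasurableSet Y' → Small Y'ᶜ → Ind (R c Y') → Ind (R c Y) := by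
    intro c
    by_cases h : ∃ Y', MeasurableSet Y' ∧ Small Y'ᶜ ∧ Ind (R c Y')
    · obtain ⟨Y, h1, h2, h3⟩ := h
      exact ⟨Y, h1, h2, fun _ _ _ _ => h3⟩
    · exact ⟨univ, .univ, ⟨∅, countable_empty, by simp, by simp⟩,
        fun Y' h1 h2 h3 => absurd ⟨Y', h1, h2, h3⟩ h⟩
  choose Yc hYm hYs hYc using hpick
  let Y₀ : Set Q := ⋂ c, Yc c
  let B : C → Set Q := fun c => {x | Ind (R c Y₀) ∧ x ∈ R c Y₀}
  have hY₀m : MeasurableSet Y₀ := MeasurableSet.iInter hYm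
  have hBm : ∀ c, MeasurableSet (B c) := fun c => (MeasurableSet.const _).inter (hRm c _ hY₀m)
  have hBs : Small (⋃ c, B c) := hSmall_iUnion _ fun c => by
    by_cases h : Ind (R c Y₀)
    · exact ⟨{R c Y₀}, countable_singleton _, by simpa using ⟨hRm c _ hY₀m, h⟩,
        fun x hx => by simpa using hx.2⟩
    · exact ⟨∅, countable_empty, by simp, fun x hx => absurd hx.1 h⟩
  let Y : Set Q := Y₀ \ ⋃ c, B c
  have hYmeas : MeasurableSet Y := hY₀m.diff (.iUnion hBm)
  have hYsmall : Small Yᶜ := by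
    have h0 : Small (⋃ c, (Yc c)ᶜ) := hSmall_iUnion _ hYs
    obtain ⟨𝓒, h1, h2, h3⟩ := h0
    obtain ⟨𝓓, h4, h5, h6⟩ := hBs
    refine ⟨𝓒 ∪ 𝓓, h1.union h4, fun s hs => hs.elim (h2 s) (h5 s), fun x hx => ?_⟩
    rw [sUnion_union]
    by_cases hx0 : x ∈ Y₀
    · exact .inr (h6 (by_contra fun h => hx ⟨hx0, h⟩))
    · refine .inl (h3 ?_)
      simpa [Y₀] using hx0
  refine ⟨Y, ?_, fun c hne hind => ?_⟩
  · by_contra h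
    rw [not_nonempty_iff_eq_empty] at h
    obtain ⟨𝓒, h1, h2, h3⟩ := hYsmall
    exact hcover ⟨𝓒, h1, h2, by rwa [h, compl_empty, univ_subset_iff] at h3⟩
  · obtain ⟨x, hx⟩ := hne
    have hi : Ind (R c Y₀) :=
      hInd _ _ (hR c (iInter_subset _ c)) (hYc c Y hYmeas hYsmall hind)
    exact (hRsub c _ hx).2 (mem_iUnion.2 ⟨c, hi, hR c sdiff_subset hx⟩)

/-- A family `𝓖` of continuous self-maps closed under composition and containing the maps `F m`
and `G m`, where `G m` inverts `F m` at the points moved by `F m`, such that any two members agree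
on a clopen set. -/
structure IsMapSystem {Q : Type} [TopologicalSpace Q] (F G : ℕ → Q → Q) (𝓖 : Set (Q → Q)) :
    Prop where
  id_mem : id ∈ 𝓖
  comp_mem : ∀ w ∈ 𝓖, ∀ v ∈ 𝓖, w ∘ v ∈ 𝓖
  F_mem : ∀ m, F m ∈ 𝓖
  G_mem : ∀ m, G m ∈ 𝓖
  cont : ∀ w ∈ 𝓖, Continuous w
  isClopen_eq : ∀ w ∈ 𝓖, ∀ v ∈ 𝓖, IsClopen {x | w x = v x}
  leftInv : ∀ m x, F m x ≠ x → G m (F m x) = x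

/-- The points of `w '' V`, expressed through a left inverse `w'` of `w`, whose whole configuration
`W` lies in `Y`. -/
def configSet {Q : Type} (V : Set Q) (W : List (Q → Q)) (w w' : Q → Q) (Y : Set Q) : Set Q :=
  {x | w' x ∈ V ∧ (∀ v ∈ W, v (w' x) ∈ Y) ∧ w (w' x) = x}

/-- A finite approximation of the construction: a set `V` of base points and a list `W` of
injective maps, some base point being sent into `Y` by all of them. -/
structure IsConfig {Q : Type} (𝓖 : Set (Q → Q)) (𝓑 : Set (Set Q)) (Y V : Set Q)
    (W : List (Q → Q)) : Prop where
  basic : V ∈ 𝓑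
  id_mem : id ∈ W
  mem : ∀ w ∈ W, w ∈ 𝓖
  inv : ∀ w ∈ W, ∃ w' ∈ 𝓖, ∀ x ∈ V, w' (w x) = x
  exists_mem : ∃ x ∈ V, ∀ w ∈ W, w x ∈ Y

/-- `(V', W ++ W ∘ h)` refines `(V, W)`, the map `h` being such that `w₀` and `w₀ ∘ h` are joined by
the graph of `F m`. -/
structure IsStep {Q : Type} [MetricSpace Q] (F : ℕ → Q → Q) (V : Set Q) (W : List (Q → Q))
    (w₀ : Q → Q) (n : ℕ) (V' : Set Q) (h : Q → Q) (m : ℕ) : Prop where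
  subset : V' ⊆ V
  mapsTo : ∀ x ∈ V', h x ∈ V
  notMem : ∀ x ∈ V', h x ∉ V'
  edge : ∀ x ∈ V', w₀ (h x) = F m (w₀ x) ∧ F m (w₀ x) ≠ w₀ x
  dist_lt : ∀ w ∈ W ++ W.map (· ∘ h), ∀ x ∈ V', ∀ y ∈ V', dist (w x) (w y) < 1 / ((n : ℝ) + 1)
  decided : ∀ i ∈ Iic n, ∀ w ∈ W ++ W.map (· ∘ h), ∀ v ∈ W ++ W.map (· ∘ h),
    (∀ x ∈ V', F i (w x) = v x) ∨ ∀ x ∈ V', ∀ y ∈ V', F i (w x) ≠ v y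

theorem IsMapSystem.exists_step {Q : Type} [MetricSpace Q] {F G : ℕ → Q → Q} {𝓖 : Set (Q → Q)}
    (hS : IsMapSystem F G 𝓖) {𝓑 : Set (Set Q)} (hB : TopologicalSpace.IsTopologicalBasis 𝓑)
    {Y : Set Q}
    (hY : ∀ V ∈ 𝓑, ∀ W : List (Q → Q), (∀ w ∈ W, w ∈ 𝓖) → ∀ w ∈ W, ∀ w' ∈ 𝓖,
      (configSet V W w w' Y).Nonempty → ∃ m, ∃ x ∈ configSet V W w w' Y,
        F m x ≠ x ∧ F m x ∈ configSet V W w w' Y)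
    {V : Set Q} {W : List (Q → Q)} (hV : IsConfig 𝓖 𝓑 Y V W) {w₀ : Q → Q} (hw₀ : w₀ ∈ W) (n : ℕ) :
    ∃ (V' : Set Q) (h : Q → Q) (m : ℕ),
      IsConfig 𝓖 𝓑 Y V' (W ++ W.map (· ∘ h)) ∧ IsStep F V W w₀ n V' h m := by
  obtain ⟨w₀', hw₀', hinv⟩ := hV.inv w₀ hw₀
  obtain ⟨p, hpV, hpY⟩ := hV.exists_mem
  obtain ⟨m, a, ⟨ha1, ha2, ha3⟩, hne, hb1, hb2, hb3⟩ := hY V hV.basic W hV.mem w₀ hw₀ w₀' hw₀'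
    ⟨w₀ p, by rw [configSet, mem_ofPred, hinv p hpV]; exact ⟨hpV, hpY, rfl⟩⟩
  have hg₀ := hV.mem w₀ hw₀
  set x₁ := w₀' a with hx₁
  set x₂ := w₀' (F m a) with hx₂
  let h : Q → Q := w₀' ∘ F m ∘ w₀
  let h' : Q → Q := w₀' ∘ G m ∘ w₀
  have hh : h ∈ 𝓖 := hS.comp_mem _ hw₀' _ (hS.comp_mem _ (hS.F_mem m) _ hg₀)
  have hh' : h' ∈ 𝓖 := hS.comp_mem _ hw₀' _ (hS.comp_mem _ (hS.G_mem m) _ hg₀)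
  have hhx : h x₁ = x₂ := by simp [h, ha3, hx₂]
  have hx12 : x₂ ≠ x₁ := fun e => hne (by rw [← hb3, e, ha3])
  have hW' : ∀ w ∈ W ++ W.map (· ∘ h), w ∈ 𝓖 := by
    intro w hw
    rcases List.mem_append.1 hw with hw | hw
    · exact hV.mem w hw
    · obtain ⟨v, hv, rfl⟩ := List.mem_map.1 hw
      exact hS.comp_mem _ (hV.mem v hv) _ hh
  have hsep : ∀ u ∈ 𝓖, ∀ v ∈ 𝓖, u x₁ ≠ v x₁ →
      ∀ᶠ N in (𝓝 x₁).smallSets, ∀ x ∈ N, ∀ y ∈ N, u x ≠ v y := by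
    intro u hu v hv huv
    obtain ⟨A, B, hA, hB, huA, hvB, hAB⟩ := t2_separation huv
    rw [Filter.eventually_smallSets]
    refine ⟨u ⁻¹' A ∩ v ⁻¹' B, Filter.inter_mem
      ((hS.cont u hu).continuousAt.preimage_mem_nhds (hA.mem_nhds huA))
      ((hS.cont v hv).continuousAt.preimage_mem_nhds (hB.mem_nhds hvB)), ?_⟩
    intro N hN x hx y hy e
    exact disjoint_left.1 hAB (hN hx).1 (e ▸ (hN hy).2)
  have heq : ∀ u ∈ 𝓖, ∀ v ∈ 𝓖, u x₁ = v x₁ →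
      ∀ᶠ N in (𝓝 x₁).smallSets, ∀ x ∈ N, u x = v x := by
    intro u hu v hv huv
    rw [Filter.eventually_smallSets_forall]
    exact (hS.isClopen_eq u hu v hv).2.mem_nhds huv
  have hfin : {w | w ∈ W ++ W.map (· ∘ h)}.Finite := List.finite_toSet _
  have hVo := hB.isOpen hV.basic
  have e1 : ∀ᶠ N in (𝓝 x₁).smallSets, ∀ x ∈ N, x ∈ V :=
    Filter.eventually_smallSets_forall.2 (hVo.mem_nhds ha1)
  have e2 : ∀ᶠ N in (𝓝 x₁).smallSets, ∀ x ∈ N, h x ∈ V :=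
    Filter.eventually_smallSets_forall.2
      ((hS.cont h hh).continuousAt.preimage_mem_nhds (hVo.mem_nhds (by rw [hhx]; exact hb1)))
  have e3 := hsep h hh id hS.id_mem (by rw [hhx]; exact hx12)
  have e4 := heq (w₀ ∘ h) (hS.comp_mem _ hg₀ _ hh) (F m ∘ w₀) (hS.comp_mem _ (hS.F_mem m) _ hg₀)
    (by simp only [Function.comp_apply]; rw [hhx, hb3, ha3])
  have e5 := hsep (F m ∘ w₀) (hS.comp_mem _ (hS.F_mem m) _ hg₀) w₀ hg₀
    (by simpa only [Function.comp_apply, ha3] using hne)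
  have e6 : ∀ᶠ N in (𝓝 x₁).smallSets, ∀ w ∈ {w | w ∈ W ++ W.map (· ∘ h)},
      ∀ x ∈ N, ∀ y ∈ N, dist (w x) (w y) < 1 / ((n : ℝ) + 1) := by
    rw [Filter.eventually_all_finite hfin]
    intro w hw
    have hpos : (0 : ℝ) < 1 / ((n : ℝ) + 1) := by positivity
    rw [Filter.eventually_smallSets]
    refine ⟨w ⁻¹' Metric.ball (w x₁) (1 / ((n : ℝ) + 1) / 2),
      (hS.cont w (hW' w hw)).continuousAt.preimage_mem_nhds
        (Metric.ball_mem_nhds _ (half_pos hpos)), fun N hN x hx y hy => ?_⟩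
    have h1 := Metric.mem_ball.1 (hN hx)
    have h2 := Metric.mem_ball'.1 (hN hy)
    linarith [dist_triangle (w x) (w x₁) (w y)]
  have e7 : ∀ᶠ N in (𝓝 x₁).smallSets, ∀ i ∈ Iic n, ∀ w ∈ {w | w ∈ W ++ W.map (· ∘ h)},
      ∀ v ∈ {w | w ∈ W ++ W.map (· ∘ h)},
      (∀ x ∈ N, F i (w x) = v x) ∨ ∀ x ∈ N, ∀ y ∈ N, F i (w x) ≠ v y := by
    rw [Filter.eventually_all_finite (finite_Iic n)]
    intro i _
    rw [Filter.eventually_all_finite hfin]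
    intro w hw
    rw [Filter.eventually_all_finite hfin]
    intro v hv
    have hFw := hS.comp_mem _ (hS.F_mem i) _ (hW' w hw)
    by_cases hc : F i (w x₁) = v x₁
    · exact (heq _ hFw v (hW' v hv) hc).mono fun N hN => .inl hN
    · exact (hsep _ hFw v (hW' v hv) hc).mono fun N hN => .inr hN
  obtain ⟨N, hN, hNP⟩ := Filter.eventually_smallSets.1
    (e1.and (e2.and (e3.and (e4.and (e5.and (e6.and e7))))))
  obtain ⟨V', hV'B, hxV', hV'N⟩ := hB.mem_nhds_iff.1 hN
  obtain ⟨k1, k2, k3, k4, k5, k6, k7⟩ := hNP V' hV'N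
  have hleft : ∀ x ∈ V', h' (h x) = x := by
    intro x hx
    have h4 : w₀ (h x) = F m (w₀ x) := k4 x hx
    simp only [h', Function.comp_apply]
    rw [h4, hS.leftInv m (w₀ x) (k5 x hx x hx), hinv x (k1 x hx)]
  refine ⟨V', h, m, ⟨hV'B, List.mem_append_left _ hV.id_mem, hW', ?_, x₁, hxV', ?_⟩,
    ⟨k1, k2, fun x hx hhx => k3 x hx (h x) hhx rfl, fun x hx => ⟨k4 x hx, k5 x hx x hx⟩, k6, k7⟩⟩
  · intro w hw
    rcases List.mem_append.1 hw with hw | hw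
    · obtain ⟨w', hw', hi⟩ := hV.inv w hw
      exact ⟨w', hw', fun x hx => hi x (k1 x hx)⟩
    · obtain ⟨v, hv, rfl⟩ := List.mem_map.1 hw
      obtain ⟨v', hv', hi⟩ := hV.inv v hv
      refine ⟨h' ∘ v', hS.comp_mem _ hh' _ hv', fun x hx => ?_⟩
      simp only [Function.comp_apply]
      rw [hi _ (k2 x hx), hleft x hx]
  · intro w hw
    rcases List.mem_append.1 hw with hw | hw
    · exact ha2 w hw
    · obtain ⟨v, hv, rfl⟩ := List.mem_map.1 hw
      simp only [Function.comp_apply, hhx]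
      exact hb2 v hv

/-- An infinite sequence of configurations in which every map of every list is eventually used as
the base of an edge. -/
theorem IsMapSystem.exists_sequence {Q : Type} [MetricSpace Q] {F G : ℕ → Q → Q}
    {𝓖 : Set (Q → Q)}
    (hS : IsMapSystem F G 𝓖) {𝓑 : Set (Set Q)} (hB : TopologicalSpace.IsTopologicalBasis 𝓑)
    {Y : Set Q} (hYne : Y.Nonempty)
    (hY : ∀ V ∈ 𝓑, ∀ W : List (Q → Q), (∀ w ∈ W, w ∈ 𝓖) → ∀ w ∈ W, ∀ w' ∈ 𝓖,
      (configSet V W w w' Y).Nonempty → ∃ m, ∃ x ∈ configSet V W w w' Y,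
        F m x ≠ x ∧ F m x ∈ configSet V W w w' Y) :
    ∃ (V : ℕ → Set Q) (W : ℕ → List (Q → Q)) (h : ℕ → Q → Q) (m : ℕ → ℕ),
      W 0 = [id] ∧ (∀ n, W (n + 1) = W n ++ (W n).map (· ∘ h n)) ∧
      (∀ n, IsConfig 𝓖 𝓑 Y (V n) (W n)) ∧
      ∀ n, IsStep F (V n) (W n) ((W n).getD n.unpair.1 id) n (V (n + 1)) (h n) (m n) := by
  obtain ⟨y, hy⟩ := hYne
  obtain ⟨V₀, hV₀, hyV₀, -⟩ := hB.exists_subset_of_mem_open (mem_univ y) isOpen_univ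
  have hstep : ∀ (n : ℕ) (s : {p : Set Q × List (Q → Q) // IsConfig 𝓖 𝓑 Y p.1 p.2}),
      ∃ (V' : Set Q) (h : Q → Q) (m : ℕ),
        IsConfig 𝓖 𝓑 Y V' (s.1.2 ++ s.1.2.map (· ∘ h)) ∧
          IsStep F s.1.1 s.1.2 (s.1.2.getD n.unpair.1 id) n V' h m := by
    intro n s
    refine hS.exists_step hB hY s.2 ?_ n
    by_cases hi : n.unpair.1 < s.1.2.length
    · rw [List.getD_eq_getElem _ _ hi]
      exact List.getElem_mem hi
    · rw [List.getD_eq_default _ _ (not_lt.1 hi)]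
      exact s.2.id_mem
  choose V' h m hcfg hst using hstep
  let s : ℕ → {p : Set Q × List (Q → Q) // IsConfig 𝓖 𝓑 Y p.1 p.2} := fun n =>
    Nat.rec ⟨(V₀, [id]), ⟨hV₀, by simp, by simpa using hS.id_mem,
      fun w hw => ⟨id, hS.id_mem, fun x _ => by rw [List.mem_singleton.1 hw]; rfl⟩,
      y, hyV₀, by simpa using hy⟩⟩
      (fun n s => ⟨(V' n s, s.1.2 ++ s.1.2.map (· ∘ h n s)), hcfg n s⟩) n
  exact ⟨fun n => (s n).1.1, fun n => (s n).1.2, fun n => h n (s n), fun n => m n (s n), rfl,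
    fun n => rfl, fun n => (s n).2, fun n => hst n (s n)⟩

/-- The maps turning level `n` of the sequence into level `n + j`. -/
def transitionMaps {Q : Type} (h : ℕ → Q → Q) (n : ℕ) : ℕ → Set (Q → Q)
  | 0 => {id}
  | j + 1 => transitionMaps h n j ∪ (· ∘ h (n + j)) '' transitionMaps h n j

theorem mem_append_map_comp {Q : Type} {W : List (Q → Q)} {h v : Q → Q} :
    v ∈ W ++ W.map (· ∘ h) ↔ v ∈ W ∨ ∃ w ∈ W, w ∘ h = v := by
  simp

/-- The limit set of a sequence of configurations. -/
def limitSet {Q : Type} (V : ℕ → Set Q) (W : ℕ → List (Q → Q)) : Set Q :=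
  {x | ∀ n, ∃ w ∈ W n, ∃ p ∈ V n, w p = x}

theorem exists_transition_of_mem {Q : Type} {W : ℕ → List (Q → Q)} {h : ℕ → Q → Q}
    (hW : ∀ n, W (n + 1) = W n ++ (W n).map (· ∘ h n)) (n : ℕ) :
    ∀ j, ∀ v ∈ W (n + j), ∃ w ∈ W n, ∃ u ∈ transitionMaps h n j, w ∘ u = v := by
  intro j
  induction j with
  | zero => exact fun v hv => ⟨v, hv, id, rfl, rfl⟩
  | succ j ih =>
    intro v hv
    rw [← add_assoc, hW, mem_append_map_comp] at hv
    rcases hv with hv | ⟨v, hv, rfl⟩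
    · obtain ⟨w, hw, u, hu, rfl⟩ := ih v hv
      exact ⟨w, hw, u, .inl hu, rfl⟩
    · obtain ⟨w, hw, u, hu, rfl⟩ := ih v hv
      exact ⟨w, hw, _, .inr ⟨u, hu, rfl⟩, rfl⟩

theorem comp_transition_mem {Q : Type} {W : ℕ → List (Q → Q)} {h : ℕ → Q → Q}
    (hW : ∀ n, W (n + 1) = W n ++ (W n).map (· ∘ h n)) (n : ℕ) {w : Q → Q} (hw : w ∈ W n) :
    ∀ j, ∀ u ∈ transitionMaps h n j, w ∘ u ∈ W (n + j) := by
  intro j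
  induction j with
  | zero => rintro u rfl; exact hw
  | succ j ih =>
    rw [← add_assoc, hW]
    rintro u (hu | ⟨u, hu, rfl⟩)
    · exact mem_append_map_comp.2 (.inl (ih u hu))
    · exact mem_append_map_comp.2 (.inr ⟨_, ih u hu, rfl⟩)

theorem transition_mapsTo {Q : Type} {V : ℕ → Set Q} {h : ℕ → Q → Q}
    (hsub : ∀ n, V (n + 1) ⊆ V n) (hmaps : ∀ n, ∀ x ∈ V (n + 1), h n x ∈ V n) (n : ℕ) :
    ∀ j, ∀ u ∈ transitionMaps h n j, ∀ x ∈ V (n + j), u x ∈ V n := by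
  intro j
  induction j with
  | zero => rintro u rfl x hx; exact hx
  | succ j ih =>
    rintro u (hu | ⟨u, hu, rfl⟩) x hx
    · exact ih u hu x (hsub _ hx)
    · exact ih u hu _ (hmaps _ _ hx)

/-- In a complete space, the construction yields a closed set on which the maps `F m` restrict to
partial maps with relatively clopen domain and range, and whose diagonal is in the closure of the
nontrivial part of the graphs. -/
theorem IsMapSystem.exists_closed {Q : Type} [MetricSpace Q] [CompleteSpace Q]
    {F G : ℕ → Q → Q} {𝓖 : Set (Q → Q)}
    (hS : IsMapSystem F G 𝓖) {𝓑 : Set (Set Q)} (hB : TopologicalSpace.IsTopologicalBasis 𝓑)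
    (hBc : ∀ b ∈ 𝓑, IsClopen b) {Y : Set Q} (hYne : Y.Nonempty)
    (hY : ∀ V ∈ 𝓑, ∀ W : List (Q → Q), (∀ w ∈ W, w ∈ 𝓖) → ∀ w ∈ W, ∀ w' ∈ 𝓖,
      (configSet V W w w' Y).Nonempty → ∃ m, ∃ x ∈ configSet V W w w' Y,
        F m x ≠ x ∧ F m x ∈ configSet V W w w' Y) :
    ∃ S : Set Q, IsClosed S ∧ S.Nonempty ∧
      (∀ x ∈ S, ∀ U, IsOpen U → x ∈ U → ∃ m, ∃ y ∈ S ∩ U, F m y ∈ S ∩ U ∧ F m y ≠ y) ∧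
      (∀ m, ∃ E, IsClopen E ∧ ∀ x ∈ S, x ∈ E ↔ F m x ≠ x ∧ F m x ∈ S) ∧
      ∀ m, ∃ E, IsClopen E ∧ ∀ y ∈ S, y ∈ E ↔ ∃ x ∈ S, F m x ≠ x ∧ F m x = y := by
  obtain ⟨V, W, h, mm, hW0, hW, hcfg, hstep⟩ := hS.exists_sequence hB hYne hY
  have hsub := fun n => (hstep n).subset
  have hmaps := fun n => (hstep n).mapsTo
  have hVanti : Antitone V := antitone_nat_of_succ_le hsub
  have hinj : ∀ n, ∀ w ∈ W n, ∀ x ∈ V n, ∀ y ∈ V n, w x = w y → x = y := by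
    intro n w hw x hx y hy e
    obtain ⟨w', -, hi⟩ := (hcfg n).inv w hw
    rw [← hi x hx, e, hi y hy]
  have hdisj : ∀ n, ∀ w ∈ W n, ∀ v ∈ W n, ∀ x ∈ V n, ∀ y ∈ V n, w x = v y → w = v := by
    intro n
    induction n with
    | zero =>
      intro w hw v hv _ _ _ _ _
      rw [hW0, List.mem_singleton] at hw hv
      rw [hw, hv]
    | succ n ih =>
      intro w hw v hv x hx y hy e
      rw [hW, mem_append_map_comp] at hw hv
      have hx' := hsub n hx
      have hy' := hsub n hy
      rcases hw with hw | ⟨w, hw, rfl⟩ <;> rcases hv with hv | ⟨v, hv, rfl⟩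
      · exact ih w hw v hv x hx' y hy' e
      · obtain rfl := ih w hw v hv x hx' _ (hmaps n y hy) e
        have := hinj n w hw x hx' _ (hmaps n y hy) e
        exact absurd (this ▸ hx) ((hstep n).notMem y hy)
      · obtain rfl := ih w hw v hv _ (hmaps n x hx) y hy' e
        have := hinj n w hw _ (hmaps n x hx) y hy' e
        exact absurd (this ▸ hy) ((hstep n).notMem x hx)
      · rw [ih w hw v hv _ (hmaps n x hx) _ (hmaps n y hy) e]
  let S := limitSet V W
  have htransfer : ∀ n, ∀ w ∈ W n, ∀ v ∈ W n, ∀ p ∈ V n, w p ∈ S → v p ∈ S := by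
    intro n w hw v hv p hp hwp k
    have hlevel : ∀ j, ∃ v' ∈ W (n + j), ∃ q ∈ V (n + j), v' q = v p := by
      intro j
      obtain ⟨w₁, hw₁, q, hq, e⟩ := hwp (n + j)
      obtain ⟨a, ha, u, hu, rfl⟩ := exists_transition_of_mem hW n j w₁ hw₁
      have huq := transition_mapsTo hsub hmaps n j u hu q hq
      obtain rfl := hdisj n a ha w hw _ huq p hp e
      have hqp : u q = p := hinj n a ha _ huq p hp e
      exact ⟨v ∘ u, comp_transition_mem hW n hv j u hu, q, hq, by rw [← hqp]; rfl⟩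
    rcases le_total n k with hnk | hkn
    · obtain ⟨j, rfl⟩ := Nat.exists_eq_add_of_le hnk
      exact hlevel j
    · obtain ⟨j, rfl⟩ := Nat.exists_eq_add_of_le hkn
      obtain ⟨a, ha, u, hu, rfl⟩ := exists_transition_of_mem hW k j v hv
      exact ⟨a, ha, u p, transition_mapsTo hsub hmaps k j u hu p hp, rfl⟩
  obtain ⟨y, hy⟩ : (⋂ n, V (n + 1)).Nonempty := by
    have hd : ∀ n, ∀ a ∈ V (n + 1), ∀ b ∈ V (n + 1), dist a b ≤ 1 / ((n : ℝ) + 1) :=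
      fun n a ha b hb => ((hstep n).dist_lt id
        (List.mem_append_left _ (hcfg n).id_mem) a ha b hb).le
    refine Metric.nonempty_iInter_of_nonempty_biInter
      (fun n => (hBc _ (hcfg _).basic).1)
      (fun n => Metric.isBounded_iff.2 ⟨_, fun a ha b hb => hd n a ha b hb⟩) (fun N => ?_) ?_
    · obtain ⟨x, hx, -⟩ := (hcfg (N + 1)).exists_mem
      exact ⟨x, mem_iInter₂.2 fun n hn => hVanti (Nat.succ_le_succ hn) hx⟩
    · exact squeeze_zero (fun n => Metric.diam_nonneg)
        (fun n => Metric.diam_le_of_forall_dist_le (by positivity) (hd n))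
        tendsto_one_div_add_atTop_nhds_zero_nat
  rw [mem_iInter] at hy
  have hyV : ∀ n, y ∈ V n := fun n => hsub n (hy n)
  have hyS : y ∈ S := fun n => ⟨id, (hcfg n).id_mem, y, hyV n, rfl⟩
  have himage : ∀ n, ∀ w ∈ W n, IsClopen (w '' V n) := by
    intro n w hw
    obtain ⟨w', hw', hi⟩ := (hcfg n).inv w hw
    have hg := (hcfg n).mem w hw
    have : w '' V n = w' ⁻¹' V n ∩ {x | (w ∘ w') x = id x} := by
      ext x
      constructor
      · rintro ⟨p, hp, rfl⟩
        refine ⟨?_, ?_⟩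
        · rw [mem_preimage, hi p hp]; exact hp
        · simp [hi p hp]
      · rintro ⟨h1, h2⟩
        exact ⟨w' x, h1, h2⟩
    rw [this]
    exact ((hBc _ (hcfg n).basic).preimage (hS.cont w' hw')).inter
      (hS.isClopen_eq _ (hS.comp_mem _ hg _ hw') _ hS.id_mem)
  have hunion : ∀ n (p : (Q → Q) → Prop),
      IsClopen (⋃ w ∈ {w | w ∈ W n ∧ p w}, w '' V n) := fun n p =>
    ((List.finite_toSet (W n)).subset fun w hw => hw.1).isClopen_biUnion
      fun w hw => himage n w hw.1
  have hdec : ∀ m, ∀ w ∈ W (m + 1), ∀ v ∈ W (m + 1), ∀ p ∈ V (m + 1), ∀ q ∈ V (m + 1),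
      F m (w p) = v q → ∀ x ∈ V (m + 1), F m (w x) = v x := by
    intro m w hw v hv p hp q hq e
    rw [hW] at hw hv
    rcases (hstep m).decided m self_mem_Iic w hw v hv with hd | hd
    · exact hd
    · exact absurd e (hd p hp q hq)
  refine ⟨S, ?_, ⟨y, hyS⟩, ?_, fun m => ?_, fun m => ?_⟩
  · have : S = ⋂ n, ⋃ w ∈ {w | w ∈ W n ∧ True}, w '' V n := by
      ext x
      simp [S, limitSet]
    rw [this]
    exact isClosed_iInter fun n => (hunion n _).1
  · intro x hx U hU hxU
    obtain ⟨δ, hδ, hball⟩ := Metric.isOpen_iff.1 hU x hxU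
    obtain ⟨n, hn⟩ := exists_nat_one_div_lt hδ
    obtain ⟨w, hw, p, hp, rfl⟩ := hx (n + 1)
    obtain ⟨i, hi, hiw⟩ := List.getElem_of_mem hw
    have hclose : ∀ q ∈ V (n + 1), w q ∈ U := by
      intro q hq
      rw [hW] at hw
      exact hball (Metric.mem_ball.2 (((hstep n).dist_lt w hw q hq p hp).trans hn))
    let k := Nat.pair i (n + 1)
    have hk : n + 1 ≤ k := Nat.right_le_pair _ _
    have hpre : ∀ j, W (n + 1) <+: W (n + 1 + j) := by
      intro j
      induction j with
      | zero => exact List.prefix_rfl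
      | succ j ih => exact ih.trans (by rw [← add_assoc, hW]; exact List.prefix_append _ _)
    have hpk : W (n + 1) <+: W k := by
      obtain ⟨j, hj⟩ := Nat.exists_eq_add_of_le hk
      rw [hj]; exact hpre j
    have hwk : w ∈ W k := hpk.subset hw
    have htarget : (W k).getD k.unpair.1 id = w := by
      rw [Nat.unpair_pair, List.getD_eq_getElem _ _ (hi.trans_le hpk.length_le), ← hiw]
      exact (hpk.getElem hi).symm
    obtain ⟨he, hne⟩ := (hstep k).edge y (hyV _)
    rw [htarget] at he hne
    have hwh : w ∘ h k ∈ W (k + 1) := by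
      rw [hW]; exact mem_append_map_comp.2 (.inr ⟨w, hwk, rfl⟩)
    refine ⟨mm k, w y, ⟨htransfer (n + 1) id (hcfg _).id_mem w hw y (hyV _) hyS,
      hclose y (hyV _)⟩, ?_, hne⟩
    rw [← he]
    exact ⟨htransfer (k + 1) id (hcfg _).id_mem (w ∘ h k) hwh y (hyV _) hyS,
      hclose _ (hVanti hk (hmaps k y (hyV _)))⟩
  · refine ⟨(⋃ w ∈ {w | w ∈ W (m + 1) ∧ ∃ v ∈ W (m + 1), ∀ x ∈ V (m + 1), F m (w x) = v x},
      w '' V (m + 1)) ∩ {x | F m x = id x}ᶜ,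
      (hunion _ _).inter (hS.isClopen_eq _ (hS.F_mem m) _ hS.id_mem).compl, fun x hx => ?_⟩
    constructor
    · rintro ⟨h1, h2⟩
      obtain ⟨w, ⟨hw, v, hv, hwv⟩, p, hp, rfl⟩ := mem_iUnion₂.1 h1
      exact ⟨h2, by rw [hwv p hp]; exact htransfer _ w hw v hv p hp hx⟩
    · rintro ⟨h1, h2⟩
      obtain ⟨w, hw, p, hp, rfl⟩ := hx (m + 1)
      obtain ⟨v, hv, q, hq, e⟩ := h2 (m + 1)
      exact ⟨mem_iUnion₂.2 ⟨w, ⟨hw, v, hv, hdec m w hw v hv p hp q hq e.symm⟩, p, hp, rfl⟩, h1⟩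
  · refine ⟨⋃ v ∈ {v | v ∈ W (m + 1) ∧ ∃ w ∈ W (m + 1), v ≠ w ∧
      ∀ x ∈ V (m + 1), F m (w x) = v x}, v '' V (m + 1), hunion _ _, fun x hx => ?_⟩
    constructor
    · intro h1
      obtain ⟨v, ⟨hv, w, hw, hne, hwv⟩, p, hp, rfl⟩ := mem_iUnion₂.1 h1
      refine ⟨w p, htransfer _ v hv w hw p hp hx, ?_, hwv p hp⟩
      rw [hwv p hp]
      exact fun e => hne (hdisj _ v hv w hw p hp p hp e)
    · rintro ⟨z, hz, h1, rfl⟩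
      obtain ⟨w, hw, p, hp, rfl⟩ := hz (m + 1)
      obtain ⟨v, hv, q, hq, e⟩ := hx (m + 1)
      have hwv := hdec m w hw v hv p hp q hq e.symm
      refine mem_iUnion₂.2 ⟨v, ⟨hv, w, hw, ?_, hwv⟩, p, hp, (hwv p hp).symm⟩
      rintro rfl
      exact h1 (hwv p hp)

/-- The map coded by a word in the letters `F m` and `G m`. -/
def wordMap {Q : Type} (F G : ℕ → Q → Q) : List (ℕ ⊕ ℕ) → Q → Q
  | [] => id
  | .inl m :: l => F m ∘ wordMap F G l
  | .inr m :: l => G m ∘ wordMap F G l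

theorem wordMap_append {Q : Type} (F G : ℕ → Q → Q) (l l' : List (ℕ ⊕ ℕ)) :
    wordMap F G (l ++ l') = wordMap F G l ∘ wordMap F G l' := by
  induction l with
  | nil => rfl
  | cons a l ih => rcases a with a | a <;> simp [wordMap, ih, Function.comp_assoc]

theorem measurable_wordMap {Q : Type} [MeasurableSpace Q] {F G : ℕ → Q → Q}
    (hF : ∀ m, Measurable (F m)) (hG : ∀ m, Measurable (G m)) (l : List (ℕ ⊕ ℕ)) :
    Measurable (wordMap F G l) := by
  induction l with
  | nil => exact measurable_id
  | cons a l ih =>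
    rcases a with a | a
    · exact (hF a).comp ih
    · exact (hG a).comp ih

/-- If a Polish space is not a countable union of Borel sets containing no nontrivial pair of the
form `(x, F m x)`, then, after refining the topology, there is a closed set on which the maps `F m`
restrict as in a converging situation. -/
theorem exists_refinement_closed {Q : Type} [σ : TopologicalSpace Q] [PolishSpace Q]
    [MeasurableSpace Q] [BorelSpace Q] {F G : ℕ → Q → Q}
    (hF : ∀ m, Measurable (F m)) (hG : ∀ m, Measurable (G m))
    (hinv : ∀ m x, F m x ≠ x → G m (F m x) = x)
    (hcover : ¬ ∃ 𝓒 : Set (Set Q), 𝓒.Countable ∧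
      (∀ s ∈ 𝓒, MeasurableSet s ∧ ∀ x ∈ s, ∀ m, F m x ≠ x → F m x ∉ s) ∧ ⋃₀ 𝓒 = univ) :
    ∃ t : TopologicalSpace Q, t ≤ σ ∧ @PolishSpace Q t ∧
      @TopologicalSpace.IsTopologicalBasis Q t {s | @IsClopen Q t s} ∧
      (∀ m, Continuous[t, t] (F m)) ∧ (∀ m, Continuous[t, t] (G m)) ∧
      ∃ S : Set Q, IsClosed[t] S ∧ S.Nonempty ∧
        (∀ x ∈ S, ∀ U, IsOpen[t] U → x ∈ U → ∃ m, ∃ y ∈ S ∩ U, F m y ∈ S ∩ U ∧ F m y ≠ y) ∧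
        (∀ m, ∃ E, @IsClopen Q t E ∧ ∀ x ∈ S, x ∈ E ↔ F m x ≠ x ∧ F m x ∈ S) ∧
        ∀ m, ∃ E, @IsClopen Q t E ∧ ∀ y ∈ S, y ∈ E ↔ ∃ x ∈ S, F m x ≠ x ∧ F m x = y := by
  let 𝓖 : Set (Q → Q) := range (wordMap F G)
  have h𝓖m : ∀ w ∈ 𝓖, Measurable w := by
    rintro _ ⟨l, rfl⟩
    exact measurable_wordMap hF hG l
  have h𝓖c : 𝓖.Countable := countable_range _
  obtain ⟨t, hle, hpol, hbasis, hcont, hclopen⟩ := exists_polish_zeroDim_refinement (σ := σ) h𝓖c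
    h𝓖m (h𝓖c.image2 h𝓖c fun w v => {x | w x = v x}) (by
      rintro _ ⟨w, hw, v, hv, rfl⟩
      exact measurableSet_eq_fun (h𝓖m w hw) (h𝓖m v hv))
  have hFm : ∀ m, F m ∈ 𝓖 := fun m => ⟨[.inl m], rfl⟩
  have hGm : ∀ m, G m ∈ 𝓖 := fun m => ⟨[.inr m], rfl⟩
  have hborel : @BorelSpace Q t _ := by
    refine @BorelSpace.mk Q t _ ?_
    rw [MeasureTheory.borel_eq_borel_of_le hpol ‹_› hle]
    exact BorelSpace.measurable_eq
  refine ⟨t, hle, hpol, hbasis, fun m => hcont _ (hFm m), fun m => hcont _ (hGm m), ?_⟩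
  clear hle
  clear! σ
  have hS : IsMapSystem F G 𝓖 :=
    { id_mem := ⟨[], rfl⟩
      comp_mem := by
        rintro _ ⟨l, rfl⟩ _ ⟨l', rfl⟩
        exact ⟨l ++ l', wordMap_append F G l l'⟩
      F_mem := hFm
      G_mem := hGm
      cont := hcont
      isClopen_eq := fun w hw v hv => hclopen _ ⟨w, hw, v, hv, rfl⟩
      leftInv := hinv }
  obtain ⟨𝓑, h𝓑, h𝓑c, hB⟩ := hbasis.exists_countable
  have : Countable 𝓑 := h𝓑c
  have : Countable 𝓖 := h𝓖c
  obtain ⟨Y, hYne, hY⟩ := exists_nonempty_stable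
    (C := {c : 𝓑 × List 𝓖 × 𝓖 × 𝓖 // c.2.2.1 ∈ c.2.1})
    (Ind := fun s => ∀ x ∈ s, ∀ m, F m x ≠ x → F m x ∉ s)
    (fun s t hst ht x hx m hne h => ht x (hst hx) m hne (hst h))
    (fun c => configSet (c.1.1 : Set Q) (c.1.2.1.map Subtype.val) c.1.2.2.1 c.1.2.2.2)
    (fun c Y Y' hYY x hx => ⟨hx.1, fun v hv => hYY (hx.2.1 v hv), hx.2.2⟩)
    (fun c Y x hx => by
      rw [← hx.2.2]
      exact hx.2.1 _ (List.mem_map_of_mem c.2))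
    (fun c Y hYm => by
      have hw' := h𝓖m _ c.1.2.2.2.2
      refine (hw' (h𝓑 c.1.1.2).2.measurableSet).inter (.inter ?_ ?_)
      · have : {x | ∀ v ∈ c.1.2.1.map Subtype.val, v ((c.1.2.2.2 : Q → Q) x) ∈ Y} =
            ⋂ v ∈ {v | v ∈ c.1.2.1.map Subtype.val}, (v ∘ (c.1.2.2.2 : Q → Q)) ⁻¹' Y := by
          ext x; simp
        change MeasurableSet {x | ∀ v ∈ c.1.2.1.map Subtype.val, v ((c.1.2.2.2 : Q → Q) x) ∈ Y}
        rw [this]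
        refine MeasurableSet.biInter (List.finite_toSet _).countable fun v hv => ?_
        obtain ⟨v, -, rfl⟩ := List.mem_map.1 hv
        exact ((h𝓖m _ v.2).comp hw') hYm
      · exact measurableSet_eq_fun ((h𝓖m _ c.1.2.2.1.2).comp hw') measurable_id)
    hcover
  let := TopologicalSpace.upgradeIsCompletelyMetrizable Q
  refine hS.exists_closed hB (fun b hb => h𝓑 hb) hYne ?_
  intro V hV W hW w hw w' hw' hne
  lift W to List 𝓖 using hW
  obtain ⟨w, hwW, rfl⟩ := List.mem_map.1 hw
  have := hY ⟨(⟨V, hV⟩, W, w, ⟨w', hw'⟩), hwW⟩ hne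
  push Not at this
  obtain ⟨x, hx, m, h1, h2⟩ := this
  exact ⟨m, x, hx, h1, h2⟩

theorem mem_unionGraphs_restrict {X : Type} {D : ℕ → Set X} {f : ℕ → X → X} {S : Set X}
    {p : S × S} :
    p ∈ unionGraphs (fun n => subD S (D n) (f n)) (fun n => subF S (f n)) ↔
      ((p.1 : X), (p.2 : X)) ∈ unionGraphs D f := by
  simp only [unionGraphs, graphRel, mem_iUnion, mem_ofPred, subD, subF]
  refine exists_congr fun n => ⟨?_, ?_⟩
  · rintro ⟨⟨h1, h2⟩, h3⟩
    rw [dif_pos h2] at h3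
    exact ⟨h1, congrArg Subtype.val h3⟩
  · rintro ⟨h1, h2⟩
    have h3 : f n p.1 ∈ S := h2 ▸ p.2.2
    exact ⟨⟨h1, h3⟩, by rw [dif_pos h3]; exact Subtype.ext h2⟩

theorem coe_subF_of_mem {X : Type} {B : Set X} {φ : X → X} {x : B} (h : φ x ∈ B) :
    (subF B φ x : X) = φ x := by
  rw [subF, dif_pos h]

theorem subF_of_notMem {X : Type} {B : Set X} {φ : X → X} {x : B} (h : φ x ∉ B) :
    subF B φ x = x := by
  rw [subF, dif_neg h]

theorem measurable_subF {X : Type} [MeasurableSpace X] {B : Set X} (hB : MeasurableSet B)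
    [MeasurableSpace B] (hval : MeasurableEmbedding (Subtype.val : B → X)) {φ : X → X}
    (hφ : Measurable φ) : Measurable (subF B φ) := by
  classical
  refine hval.measurable_comp_iff.1 ?_
  have : Subtype.val ∘ subF B φ = fun x : B => if φ x ∈ B then φ x else (x : X) := by
    ext x
    by_cases h : φ x ∈ B
    · simp [coe_subF_of_mem h, h]
    · simp [subF_of_notMem h, h]
  rw [this]
  exact Measurable.ite ((hφ.comp hval.measurable) hB) (hφ.comp hval.measurable) hval.measurable

theorem continuous_piecewise_id {X : Type} [TopologicalSpace X] {D : Set X} (hD : IsClopen D)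
    {f : X → X} (hf : ContinuousOn f D) [∀ x, Decidable (x ∈ D)] :
    Continuous (D.piecewise f id) := by
  refine continuous_piecewise ?_ (by rwa [hD.1.closure_eq]) continuousOn_id
  simp [hD.frontier_eq]

/-- A part of the space covered by countably many Borel sets free of edges carries a potentially
closed restriction of the relation. -/
theorem potClosed_of_countable_cover {X : Type} [t : TopologicalSpace X] [PolishSpace X]
    [MeasurableSpace X] [BorelSpace X] {A : Set (X × X)} (hA : closure A ⊆ A ∪ diagonal X)
    {P : Set X} (hP : MeasurableSet P) {𝓒 : Set (Set X)} (hc : 𝓒.Countable)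
    (hm : ∀ C ∈ 𝓒, MeasurableSet C) (hfree : ∀ C ∈ 𝓒, ∀ x ∈ C, ∀ y ∈ C, (x, y) ∉ A)
    (hcover : P ⊆ ⋃₀ 𝓒) : PotClosed t t (A ∩ P ×ˢ P) := by
  have hopen : IsOpen (closure A)ᶜ := isClosed_closure.isOpen_compl
  have hclA : (closure A)ᶜ ⊆ (A ∩ P ×ˢ P)ᶜ :=
    compl_subset_compl.2 (inter_subset_left.trans subset_closure)
  have hoff : ∀ p ∉ A, p.1 ≠ p.2 → p ∈ (closure A)ᶜ := fun p hpA hne hcl =>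
    (hA hcl).elim hpA hne
  clear hA
  generalize (closure A)ᶜ = O at *
  obtain ⟨t', hle, hpol, hcl⟩ := exists_polish_forall_isClopen (hc.insert P)
    (by rintro C (rfl | hC); exacts [hP, hm C hC])
  refine ⟨t', t', hle, hle, hpol, hpol, ?_⟩
  have hprod : @instTopologicalSpaceProd X X t' t' ≤ @instTopologicalSpaceProd X X t t :=
    inf_le_inf (induced_mono hle) (induced_mono hle)
  have hopen' := hprod _ hopen
  have hfree' : ∀ C ∈ 𝓒, C ×ˢ C ⊆ (A ∩ P ×ˢ P)ᶜ := fun C hC p hp hpA =>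
    hfree C hC p.1 hp.1 p.2 hp.2 hpA.1
  clear hopen hprod
  clear! t
  have hPc := hcl P (mem_insert _ _)
  rw [← isOpen_compl_iff, isOpen_iff_mem_nhds]
  intro p hp
  by_cases h1 : p.1 ∈ P
  · by_cases h2 : p.2 ∈ P
    · have hpA : p ∉ A := fun h => hp ⟨h, h1, h2⟩
      by_cases h3 : p.1 = p.2
      · obtain ⟨C, hC, hpC⟩ := hcover h1
        have hCo := (hcl C (mem_insert_of_mem _ hC)).2
        exact Filter.mem_of_superset ((hCo.prod hCo).mem_nhds ⟨hpC, h3 ▸ hpC⟩) (hfree' C hC)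
      · exact Filter.mem_of_superset (hopen'.mem_nhds (hoff p hpA h3)) hclA
    · exact Filter.mem_of_superset ((hPc.compl.2.preimage continuous_snd).mem_nhds h2)
        fun q hq hqA => hq hqA.2.2
  · exact Filter.mem_of_superset ((hPc.compl.2.preimage continuous_fst).mem_nhds h1)
      fun q hq hqA => hq hqA.2.1

/-- Criterion for the restriction of a converging situation to a subset to be again converging,
in a finer topology given on a larger subset. -/
theorem convSit_of_isClosed {X : Type} {t : TopologicalSpace X} {D : ℕ → Set X} {f : ℕ → X → X}
    (hdiag : diagonal X = closure (unionGraphs D f) \ unionGraphs D f)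
    {P : Set X} [σ : TopologicalSpace P] [PolishSpace P]
    (hval : Continuous[σ, t] (Subtype.val : P → X))
    (hbasis : TopologicalSpace.IsTopologicalBasis {s : Set P | IsClopen s})
    {F G : ℕ → P → P} (hF : ∀ m, Continuous (F m)) (hG : ∀ m, Continuous (G m))
    (hFne : ∀ m x, F m x ≠ x ↔ (x : X) ∈ D m ∧ f m x ∈ P)
    (hFval : ∀ m x, F m x ≠ x → (F m x : X) = f m x)
    (hinv : ∀ m x, F m x ≠ x → G m (F m x) = x)
    {B : Set X} (hB : B ⊆ P) (hclosed : IsClosed (Subtype.val ⁻¹' B : Set P)) (hne : B.Nonempty)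
    (hedge : ∀ x : P, (x : X) ∈ B → ∀ U, IsOpen U → x ∈ U →
      ∃ m, ∃ y ∈ U, (y : X) ∈ B ∧ F m y ∈ U ∧ (F m y : X) ∈ B ∧ F m y ≠ y)
    (hdom : ∀ m, ∃ E : Set P, IsClopen E ∧
      ∀ x : P, (x : X) ∈ B → (x ∈ E ↔ F m x ≠ x ∧ (F m x : X) ∈ B))
    (hran : ∀ m, ∃ E : Set P, IsClopen E ∧
      ∀ y : P, (y : X) ∈ B → (y ∈ E ↔ ∃ x : P, (x : X) ∈ B ∧ F m x ≠ x ∧ F m x = y)) :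
    ConvSit B (σ.induced (inclusion hB)) (fun n => subD B (D n) (f n)) (fun n => subF B (f n)) := by
  let τ : TopologicalSpace B := σ.induced (inclusion hB)
  let e : B → P := inclusion hB
  have hrange : range e = Subtype.val ⁻¹' B := by
    ext x; exact ⟨by rintro ⟨b, rfl⟩; exact b.2, fun h => ⟨⟨x, h⟩, rfl⟩⟩
  have he : IsClosedEmbedding e :=
    ⟨⟨⟨rfl⟩, inclusion_injective hB⟩, by rw [hrange]; exact hclosed⟩
  have hvale : Continuous[τ, t] (Subtype.val : B → X) :=
    @Continuous.comp _ _ _ τ σ t _ _ hval he.continuous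
  have hsubD : ∀ m (x : B), x ∈ subD B (D m) (f m) ↔ F m (e x) ≠ e x ∧ (F m (e x) : X) ∈ B := by
    refine fun m x => ⟨fun ⟨h1, h2⟩ => ?_, fun ⟨h1, h2⟩ => ?_⟩
    · have h := (hFne m (e x)).2 ⟨h1, hB h2⟩
      exact ⟨h, by rw [hFval m _ h]; exact h2⟩
    · exact ⟨((hFne m (e x)).1 h1).1, by rw [hFval m _ h1] at h2; exact h2⟩
  have hsubF : ∀ m, ∀ x ∈ subD B (D m) (f m), e (subF B (f m) x) = F m (e x) := by
    intro m x hx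
    refine Subtype.ext ?_
    rw [hFval m _ ((hsubD m x).1 hx).1]
    exact coe_subF_of_mem hx.2
  have hpairs : ∀ x : B, ∀ U, IsOpen U → x ∈ U →
      ∃ p ∈ unionGraphs (fun n => subD B (D n) (f n)) (fun n => subF B (f n)),
        p.1 ∈ U ∧ p.2 ∈ U ∧ p.1 ≠ p.2 := by
    rintro x U hU hxU
    obtain ⟨V, hV, rfl⟩ := hU
    obtain ⟨m, y, hyV, hyB, hFV, hFB, hFy⟩ := hedge (e x) x.2 V hV hxU
    have hmem : (⟨y, hyB⟩ : B) ∈ subD B (D m) (f m) := (hsubD m _).2 ⟨hFy, hFB⟩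
    have hval' := hsubF m _ hmem
    refine ⟨(⟨y, hyB⟩, subF B (f m) ⟨y, hyB⟩), mem_iUnion.2 ⟨m, hmem, rfl⟩, hyV, ?_, fun h => ?_⟩
    · change e _ ∈ V
      rw [hval']; exact hFV
    · exact hFy (hval'.symm.trans (congrArg e h.symm))
  have : Nonempty B := hne.to_subtype
  refine ⟨‹_›, he.polishSpace, ?_, ⟨isClosed_univ, fun x _ => ?_⟩, fun m => ⟨?_, ?_, ?_, ?_⟩, ?_⟩
  · refine TopologicalSpace.isTopologicalBasis_of_isOpen_of_nhds (fun s hs => hs.2) ?_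
    rintro x _ hxU ⟨V, hV, rfl⟩
    obtain ⟨W, hW, hxW, hWV⟩ := hbasis.exists_subset_of_mem_open hxU hV
    exact ⟨e ⁻¹' W, hW.preimage he.continuous, hxW, preimage_mono hWV⟩
  · rw [accPt_iff_nhds]
    intro N hN
    obtain ⟨U, hUN, hU, hxU⟩ := mem_nhds_iff.1 hN
    obtain ⟨p, -, h1, h2, h12⟩ := hpairs x U hU hxU
    by_cases h : p.1 = x
    · exact ⟨p.2, ⟨hUN h2, trivial⟩, fun h' => h12 (h.trans h'.symm)⟩
    · exact ⟨p.1, ⟨hUN h1, trivial⟩, h⟩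
  · obtain ⟨E, hE, hEB⟩ := hdom m
    have : subD B (D m) (f m) = e ⁻¹' E := ext fun x => (hsubD m x).trans (hEB (e x) x.2).symm
    change IsClopen (subD B (D m) (f m))
    rw [this]
    exact hE.preimage he.continuous
  · obtain ⟨E, hE, hEB⟩ := hran m
    have : subF B (f m) '' subD B (D m) (f m) = e ⁻¹' E := by
      ext y
      refine Iff.trans ⟨?_, ?_⟩ (hEB (e y) y.2).symm
      · rintro ⟨x, hx, rfl⟩
        exact ⟨e x, x.2, ((hsubD m x).1 hx).1, (hsubF m x hx).symm⟩
      · rintro ⟨x, hxB, hx, hxy⟩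
        have hmem : (⟨x, hxB⟩ : B) ∈ subD B (D m) (f m) :=
          (hsubD m _).2 ⟨hx, by change (F m x : X) ∈ B; rw [hxy]; exact y.2⟩
        exact ⟨_, hmem, he.injective ((hsubF m _ hmem).trans hxy)⟩
    change IsClopen (subF B (f m) '' subD B (D m) (f m))
    rw [this]
    exact hE.preimage he.continuous
  · refine he.isInducing.continuousOn_iff.2 ?_
    exact ((hF m).comp he.continuous).continuousOn.congr (hsubF m)
  · refine ⟨fun y => Function.invFun e (G m (e y)), ?_, fun x hx => ?_⟩
    · refine he.isInducing.continuousOn_iff.2 ?_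
      refine ((hG m).comp he.continuous).continuousOn.congr ?_
      rintro _ ⟨x, hx, rfl⟩
      refine Function.invFun_eq ⟨x, ?_⟩
      rw [hsubF m x hx, hinv m _ ((hsubD m x).1 hx).1]
    · change Function.invFun e (G m (e _)) = x
      rw [hsubF m x hx, hinv m _ ((hsubD m x).1 hx).1]
      exact Function.leftInverse_invFun he.injective x
  · ext p
    constructor
    · intro hp
      obtain ⟨x, y⟩ := p
      obtain rfl : x = y := hp
      refine ⟨mem_closure_iff_nhds.2 fun N hN => ?_, fun h => ?_⟩
      · rw [nhds_prod_eq] at hN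
        obtain ⟨V, hV, hVN⟩ := Filter.mem_prod_same_iff.1 hN
        obtain ⟨U, hUV, hU, hxU⟩ := mem_nhds_iff.1 hV
        obtain ⟨p, hp, h1, h2, -⟩ := hpairs x U hU hxU
        exact ⟨p, hVN ⟨hUV h1, hUV h2⟩, hp⟩
      · have h' : ((x : X), (x : X)) ∈ closure (unionGraphs D f) \ unionGraphs D f :=
          hdiag ▸ rfl
        exact h'.2 (mem_unionGraphs_restrict.1 h)
    · rintro ⟨h1, h2⟩
      have hcont : Continuous fun q : B × B => ((q.1 : X), (q.2 : X)) :=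
        (hvale.comp continuous_fst).prodMk (hvale.comp continuous_snd)
      have h3 := map_mem_closure hcont h1 fun q hq => mem_unionGraphs_restrict.1 hq
      have h4 : ((p.1 : X), (p.2 : X)) ∈ diagonal X :=
        hdiag ▸ ⟨h3, fun h => h2 (mem_unionGraphs_restrict.2 h)⟩
      exact Subtype.ext h4

theorem stmt6 {X : Type} (t : TopologicalSpace X) (D : ℕ → Set X) (f : ℕ → X → X)
    (hconv : ConvSit X t D f)
    (P : Set X) (hP : @MeasurableSet X (@borel X t) P)
    (σ : TopologicalSpace ↥P) (hσ : σ ≤ subTop t P) (hσP : @PolishSpace ↥P σ)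
    (hnotpot : ¬ PotClosed t t (unionGraphs D f ∩ P ×ˢ P)) :
    ∃ (S : Set X) (hSP : S ⊆ P) (τ : TopologicalSpace ↥S),
      @MeasurableSet X (@borel X t) S ∧
      τ ≤ @TopologicalSpace.induced ↥S ↥P (Set.inclusion hSP) σ ∧
      ConvSit ↥S τ (fun n => subD S (D n) (f n)) (fun n => subF S (f n)) := by
  classical
  obtain ⟨-, hpol, -, -, hpart, hdiag⟩ := hconv
  have hirr : ∀ x, (x, x) ∉ unionGraphs D f := fun x h =>
    (hdiag ▸ (rfl : x = x) : (x, x) ∈ closure (unionGraphs D f) \ unionGraphs D f).2 h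
  have hmemA : ∀ m, ∀ x ∈ D m, (x, f m x) ∈ unionGraphs D f := fun m x hx =>
    mem_iUnion.2 ⟨m, hx, rfl⟩
  have hfne : ∀ m, ∀ x ∈ D m, f m x ≠ x := fun m x hx h => hirr x (by
    have := hmemA m x hx
    rwa [h] at this)
  choose hD hR hfc g hg hgf using hpart
  let _ : MeasurableSpace X := borel X
  have : BorelSpace X := ⟨rfl⟩
  let _ : MeasurableSpace P := @borel P σ
  have : @BorelSpace P σ _ := @BorelSpace.mk P σ _ rfl
  have hcval : ∀ s : TopologicalSpace P, s ≤ σ → Continuous[s, t] (Subtype.val : P → X) :=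
    fun s hs => continuous_iff_le_induced.2 (hs.trans hσ)
  have hval : MeasurableEmbedding (Subtype.val : P → X) :=
    Continuous.measurableEmbedding (hcval σ le_rfl)
      Subtype.val_injective
  let F0 : ℕ → X → X := fun m => (D m).piecewise (f m) id
  let G0 : ℕ → X → X := fun m => (f m '' D m).piecewise (g m) id
  have hF0 : ∀ m, ∀ x ∈ D m, F0 m x = f m x := fun m x hx => piecewise_eq_of_mem _ _ _ hx
  have hF0' : ∀ m, ∀ x ∉ D m, F0 m x = x := fun m x hx => piecewise_eq_of_notMem _ _ _ hx
  have hG0 : ∀ m, ∀ x ∈ D m, G0 m (f m x) = x := fun m x hx =>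
    (piecewise_eq_of_mem _ _ _ (mem_image_of_mem _ hx)).trans (hgf m x hx)
  let F : ℕ → P → P := fun m => subF P (F0 m)
  let G : ℕ → P → P := fun m => subF P (G0 m)
  have hFm : ∀ m, Measurable (F m) := fun m =>
    measurable_subF hP hval (continuous_piecewise_id (hD m) (hfc m)).measurable
  have hGm : ∀ m, Measurable (G m) := fun m =>
    measurable_subF hP hval (continuous_piecewise_id (hR m) (hg m)).measurable
  have hFD : ∀ m (x : P), (x : X) ∈ D m → f m x ∈ P → (F m x : X) = f m x := by
    intro m x h1 h2
    rw [← hF0 m x h1] at h2 ⊢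
    exact coe_subF_of_mem h2
  have hFne : ∀ m x, F m x ≠ x ↔ (x : X) ∈ D m ∧ f m x ∈ P := by
    refine fun m x => ⟨fun h => ?_, fun ⟨h1, h2⟩ h => ?_⟩
    · have h1 : (x : X) ∈ D m := by
        by_contra h1
        refine h (Subtype.ext ?_)
        have h2 := hF0' m x h1
        exact (coe_subF_of_mem (by rw [h2]; exact x.2)).trans h2
      refine ⟨h1, ?_⟩
      by_contra h2
      exact h (subF_of_notMem (by rwa [hF0 m x h1]))
    · exact hfne m x h1 (by rw [← hFD m x h1 h2, h])
  have hFval : ∀ m x, F m x ≠ x → (F m x : X) = f m x := fun m x h =>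
    hFD m x ((hFne m x).1 h).1 ((hFne m x).1 h).2
  have hinv : ∀ m x, F m x ≠ x → G m (F m x) = x := by
    intro m x h
    have h1 : G0 m (F m x) = x := by
      rw [hFval m x h]
      exact hG0 m x ((hFne m x).1 h).1
    exact Subtype.ext ((coe_subF_of_mem (by rw [h1]; exact x.2)).trans h1)
  have hcover : ¬ ∃ 𝓒 : Set (Set P), 𝓒.Countable ∧
      (∀ s ∈ 𝓒, MeasurableSet s ∧ ∀ x ∈ s, ∀ m, F m x ≠ x → F m x ∉ s) ∧ ⋃₀ 𝓒 = univ := by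
    rintro ⟨𝓒, hc, h𝓒, huniv⟩
    refine hnotpot (potClosed_of_countable_cover ?_ hP (hc.image (Subtype.val '' ·)) ?_ ?_ ?_)
    · intro p hp
      by_cases h : p ∈ unionGraphs D f
      · exact .inl h
      · exact .inr (hdiag ▸ ⟨hp, h⟩)
    · rintro _ ⟨s, hs, rfl⟩
      exact hval.measurableSet_image.2 (h𝓒 s hs).1
    · rintro _ ⟨s, hs, rfl⟩ _ ⟨x, hx, rfl⟩ _ ⟨y, hy, rfl⟩ h
      obtain ⟨m, h1, h2⟩ := mem_iUnion.1 h
      change (y : X) = f m x at h2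
      have h3 : F m x ≠ x := (hFne m x).2 ⟨h1, h2 ▸ y.2⟩
      have h4 : F m x = y := Subtype.ext ((hFval m x h3).trans h2.symm)
      exact (h𝓒 s hs).2 x hx m h3 (h4 ▸ hy)
    · intro x hx
      obtain ⟨s, hs, hxs⟩ := (huniv ▸ mem_univ _ : (⟨x, hx⟩ : P) ∈ ⋃₀ 𝓒)
      exact ⟨_, mem_image_of_mem _ hs, _, hxs, rfl⟩
  obtain ⟨s, hle, hpol', hbasis, hFc, hGc, S, hS, hne, hedge, hdom, hran⟩ :=
    @exists_refinement_closed P σ hσP _ _ F G hFm hGm hinv hcover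
  have hSP : Subtype.val '' S ⊆ P := by rintro _ ⟨x, -, rfl⟩; exact x.2
  have hmem : ∀ x : P, (x : X) ∈ Subtype.val '' S ↔ x ∈ S := fun x =>
    Subtype.val_injective.mem_set_image
  refine ⟨Subtype.val '' S, hSP, s.induced (inclusion hSP), ?_, induced_mono hle, ?_⟩
  · exact hS.measurableSet_image_of_continuousOn_injOn (hcval s hle).continuousOn
      Subtype.val_injective.injOn
  · refine @convSit_of_isClosed X t D f hdiag P s hpol' (hcval s hle) hbasis F G hFc hGc hFne hFval
      hinv _ hSP ?_ (hne.image _) ?_ ?_ ?_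
    · rwa [preimage_image_eq _ Subtype.val_injective]
    · intro x hx U hU hxU
      obtain ⟨m, y, hy, hFy, h⟩ := hedge x ((hmem x).1 hx) U hU hxU
      exact ⟨m, y, hy.2, (hmem _).2 hy.1, hFy.2, (hmem _).2 hFy.1, h⟩
    · simpa only [hmem] using hdom
    · simpa only [hmem, exists_prop] using hran
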